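/- Soundness and completeness of ETDC: for all sms data α and β, there is an ETDC-deduction of β from α if and only if α ≃_ET β (in every model, α and β have exactly the same truthmakers under the exact truthmaker semantics). -/

import Mathlib

/-- Formulas of classical propositional logic: propositional variables,
negation, conjunction, disjunction. -/
inductive Fml : Type
  | var : ℕ → Fml
  | neg : Fml → Fml
  | conj : Fml → Fml → Fml
  | disj : Fml → Fml → Fml
  deriving DecidableEq

/-- A datum: a finite set of finite sets (components) of formulas. -/
abbrev Datum := Finset (Finset Fml)

/-- Truth-value of a formula under an interpretation of the variables. -/
def Fml.eval (v : ℕ → Bool) : Fml → Bool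
  | .var n => v n
  | .neg A => !A.eval v
  | .conj A B => A.eval v && B.eval v
  | .disj A B => A.eval v || B.eval v

/-- An interpretation verifies a datum iff some component has all its
formulas true. -/
def Verifies (v : ℕ → Bool) (α : Datum) : Prop :=
  ∃ Γ ∈ α, ∀ A ∈ Γ, A.eval v = true

/-- The exact (basic) truthmaker semantics: the bilateral proposition
(truthmaker set, falsity-maker set) assigned to a formula, given an
assignment `σ` of bilateral propositions over a set `S` of elementary
situations to the propositional variables. States are subsets of `S`. -/
def Sem {S : Type} (σ : ℕ → Set (Set S) × Set (Set S)) :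
    Fml → Set (Set S) × Set (Set S)
  | .var p => σ p
  | .neg A => ((Sem σ A).2, (Sem σ A).1)
  | .conj A B =>
      ({s | ∃ s₁ ∈ (Sem σ A).1, ∃ s₂ ∈ (Sem σ B).1, s = s₁ ∪ s₂},
       (Sem σ A).2 ∪ (Sem σ B).2)
  | .disj A B =>
      ((Sem σ A).1 ∪ (Sem σ B).1,
       {s | ∃ s₁ ∈ (Sem σ A).2, ∃ s₂ ∈ (Sem σ B).2, s = s₁ ∪ s₂})

/-- `σ` is a model-assignment: each variable gets a bilateral proposition,
i.e. a pair of sets of states with distinct components. -/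
def IsModel {S : Type} (σ : ℕ → Set (Set S) × Set (Set S)) : Prop :=
  ∀ p : ℕ, (σ p).1 ≠ (σ p).2

/-- An sms datum: a finite set of finite multisets (components) of formulas. -/
abbrev SmsDatum := Finset (Multiset Fml)

/-- The G-rules of ETDC acting on multiset components, in the analytic
direction. -/
inductive MGStep : SmsDatum → SmsDatum → Prop
  | conj (Γ : Multiset Fml) (A B : Fml) (ρ : SmsDatum) :
      MGStep (insert ((Fml.conj A B) ::ₘ Γ) ρ)
             (insert (A ::ₘ B ::ₘ Γ) ρ)
  | disj (Γ : Multiset Fml) (A B : Fml) (ρ : SmsDatum) :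
      MGStep (insert ((Fml.disj A B) ::ₘ Γ) ρ)
             (insert (A ::ₘ Γ) (insert (B ::ₘ Γ) ρ))
  | negneg (Γ : Multiset Fml) (A : Fml) (ρ : SmsDatum) :
      MGStep (insert ((Fml.neg (Fml.neg A)) ::ₘ Γ) ρ)
             (insert (A ::ₘ Γ) ρ)
  | negdisj (Γ : Multiset Fml) (A B : Fml) (ρ : SmsDatum) :
      MGStep (insert ((Fml.neg (Fml.disj A B)) ::ₘ Γ) ρ)
             (insert ((Fml.neg A) ::ₘ (Fml.neg B) ::ₘ Γ) ρ)
  | negconj (Γ : Multiset Fml) (A B : Fml) (ρ : SmsDatum) :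
      MGStep (insert ((Fml.neg (Fml.conj A B)) ::ₘ Γ) ρ)
             (insert ((Fml.neg A) ::ₘ Γ) (insert ((Fml.neg B) ::ₘ Γ) ρ))

/-- Γ₀ is an inferior replica of Γ: same underlying set of formulas, with
each multiplicity in Γ₀ at most that in Γ. -/
def InferiorReplica (Γ₀ Γ : Multiset Fml) : Prop :=
  Γ₀.toFinset = Γ.toFinset ∧ Γ₀ ≤ Γ

/-- The Inferior Replica rule ↑IR: in the presence of a component Γ, add a
component Γ₀ which is an inferior replica of Γ. (Its inverse is ↓IR.) -/
def IRAdd (α β : SmsDatum) : Prop :=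
  ∃ (Γ Γ₀ : Multiset Fml) (ρ : SmsDatum),
    InferiorReplica Γ₀ Γ ∧ α = insert Γ ρ ∧ β = insert Γ (insert Γ₀ ρ)

/-- One step of ETDC: the G-rules and the Inferior Replica rules, each in
both directions. -/
def ETDCStep (α β : SmsDatum) : Prop :=
  MGStep α β ∨ MGStep β α ∨ IRAdd α β ∨ IRAdd β α

/-- The exact truthmakers of a multiset component, read as the conjunction
of its formula occurrences: unions of one chosen truthmaker per occurrence. -/
def MsetTM {S : Type} (σ : ℕ → Set (Set S) × Set (Set S))
    (Γ : Multiset Fml) : Set (Set S) :=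
  {s | ∃ L : List (Fml × Set S),
        (↑(L.map Prod.fst) : Multiset Fml) = Γ ∧
        (∀ p ∈ L, p.2 ∈ (Sem σ p.1).1) ∧
        s = ⋃ p ∈ L, p.2}

/-- The exact truthmakers of an sms datum, read as the disjunction of its
components. -/
def SmsTM {S : Type} (σ : ℕ → Set (Set S) × Set (Set S)) (α : SmsDatum) :
    Set (Set S) :=
  ⋃ Γ ∈ α, MsetTM σ Γ

/-- ET equivalence of sms data: the same truthmakers in every model under
the exact truthmaker semantics. -/
def ETEquiv (α β : SmsDatum) : Prop :=
  ∀ (S : Type) (σ : ℕ → Set (Set S) × Set (Set S)), IsModel σ →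
    SmsTM σ α = SmsTM σ β

theorem msetTM_zero {S : Type} (σ : ℕ → Set (Set S) × Set (Set S)) (s : Set S) :
    s ∈ MsetTM σ 0 ↔ s = ∅ := by
  constructor
  · rintro ⟨L, h1, h2, h3⟩
    simp only [Multiset.coe_eq_zero, List.map_eq_nil_iff] at h1
    subst h1
    simpa using h3
  · rintro rfl
    exact ⟨[], by simp⟩

theorem msetTM_cons {S : Type} (σ : ℕ → Set (Set S) × Set (Set S)) (A : Fml)
    (Γ : Multiset Fml) (s : Set S) :
    s ∈ MsetTM σ (A ::ₘ Γ) ↔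
      ∃ s₁ ∈ (Sem σ A).1, ∃ s₂ ∈ MsetTM σ Γ, s = s₁ ∪ s₂ := by
  constructor
  · rintro ⟨L, h1, h2, h3⟩
    have hA : A ∈ (↑(L.map Prod.fst) : Multiset Fml) := by rw [h1]; simp
    rw [Multiset.mem_coe, List.mem_map] at hA
    obtain ⟨p, hp, rfl⟩ := hA
    obtain ⟨L1, L2, rfl⟩ := List.append_of_mem hp
    refine ⟨p.2, h2 p hp, ⋃ q ∈ L1 ++ L2, q.2, ⟨L1 ++ L2, ?_, ?_, rfl⟩, ?_⟩
    · apply (Multiset.cons_inj_right p.1).1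
      rw [← h1, Multiset.cons_coe, Multiset.coe_eq_coe]
      simp only [List.map_append, List.map_cons]
      exact List.perm_middle.symm
    · intro q hq
      apply h2
      simp only [List.mem_append, List.mem_cons] at hq ⊢
      tauto
    · rw [h3]
      ext x
      simp only [Set.mem_iUnion, Set.mem_union, List.mem_append, List.mem_cons, exists_prop]
      constructor
      · rintro ⟨q, hq | rfl | hq, hx⟩
        · exact Or.inr ⟨q, Or.inl hq, hx⟩
        · exact Or.inl hx
        · exact Or.inr ⟨q, Or.inr hq, hx⟩
      · rintro (hx | ⟨q, hq | hq, hx⟩)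
        · exact ⟨p, Or.inr (Or.inl rfl), hx⟩
        · exact ⟨q, Or.inl hq, hx⟩
        · exact ⟨q, Or.inr (Or.inr hq), hx⟩
  · rintro ⟨s₁, hs, s₂, ⟨L, h1, h2, rfl⟩, rfl⟩
    refine ⟨(A, s₁) :: L, ?_, ?_, ?_⟩
    · rw [← h1]; simp
    · intro p hp
      rcases List.mem_cons.1 hp with rfl | hp
      · exact hs
      · exact h2 p hp
    · simp

theorem smsTM_insert {S : Type} (σ : ℕ → Set (Set S) × Set (Set S)) (Γ : Multiset Fml)
    (ρ : SmsDatum) : SmsTM σ (insert Γ ρ) = MsetTM σ Γ ∪ SmsTM σ ρ := by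
  simp [SmsTM]

theorem mg_sound {S : Type} (σ : ℕ → Set (Set S) × Set (Set S)) {α β : SmsDatum}
    (h : MGStep α β) : SmsTM σ α = SmsTM σ β := by
  cases h with
  | conj Γ A B ρ =>
    simp only [smsTM_insert]
    congr 1
    ext s
    simp only [msetTM_cons, Sem, Set.mem_setOf_eq]
    constructor
    · rintro ⟨_, ⟨a, ha, b, hb, rfl⟩, c, hc, rfl⟩
      exact ⟨a, ha, _, ⟨b, hb, c, hc, rfl⟩, Set.union_assoc _ _ _⟩
    · rintro ⟨a, ha, _, ⟨b, hb, c, hc, rfl⟩, rfl⟩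
      exact ⟨_, ⟨a, ha, b, hb, rfl⟩, c, hc, (Set.union_assoc _ _ _).symm⟩
  | disj Γ A B ρ =>
    simp only [smsTM_insert]
    rw [← Set.union_assoc]
    congr 1
    ext s
    simp only [msetTM_cons, Sem, Set.mem_union, or_and_right, exists_or]
  | negneg Γ A ρ =>
    simp only [smsTM_insert]
    congr 1
    ext s
    simp only [msetTM_cons, Sem]
  | negdisj Γ A B ρ =>
    simp only [smsTM_insert]
    congr 1
    ext s
    simp only [msetTM_cons, Sem, Set.mem_setOf_eq]
    constructor
    · rintro ⟨_, ⟨a, ha, b, hb, rfl⟩, c, hc, rfl⟩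
      exact ⟨a, ha, _, ⟨b, hb, c, hc, rfl⟩, Set.union_assoc _ _ _⟩
    · rintro ⟨a, ha, _, ⟨b, hb, c, hc, rfl⟩, rfl⟩
      exact ⟨_, ⟨a, ha, b, hb, rfl⟩, c, hc, (Set.union_assoc _ _ _).symm⟩
  | negconj Γ A B ρ =>
    simp only [smsTM_insert]
    rw [← Set.union_assoc]
    congr 1
    ext s
    simp only [msetTM_cons, Sem, Set.mem_union, or_and_right, exists_or]

theorem msetTM_add {S : Type} (σ : ℕ → Set (Set S) × Set (Set S)) (Γ : Multiset Fml)
    (Δ : Multiset Fml) (h : ∀ A ∈ Δ, A ∈ Γ) : MsetTM σ Γ ⊆ MsetTM σ (Δ + Γ) := by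
  induction Δ using Multiset.induction_on with
  | empty => simp
  | cons A Δ ih =>
    intro s hs
    have hs' := ih (fun B hB => h B (Multiset.mem_cons_of_mem hB)) hs
    have hA : A ∈ Δ + Γ := Multiset.mem_add.2 (Or.inr (h A (Multiset.mem_cons_self _ _)))
    obtain ⟨Θ, hΘ⟩ := Multiset.exists_cons_of_mem hA
    rw [Multiset.cons_add, msetTM_cons]
    have hs2 := hs'
    rw [hΘ, msetTM_cons] at hs2
    obtain ⟨a, ha, b, hb, rfl⟩ := hs2
    exact ⟨a, ha, _, hs', by rw [← Set.union_assoc, Set.union_self]⟩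

theorem ir_sound {S : Type} (σ : ℕ → Set (Set S) × Set (Set S)) {α β : SmsDatum}
    (h : IRAdd α β) : SmsTM σ α = SmsTM σ β := by
  obtain ⟨Γ, Γ₀, ρ, ⟨h1, h2⟩, rfl, rfl⟩ := h
  obtain ⟨Δ, rfl⟩ := Multiset.le_iff_exists_add.1 h2
  have : MsetTM σ Γ₀ ⊆ MsetTM σ (Γ₀ + Δ) := by
    rw [add_comm]
    apply msetTM_add
    intro A hA
    rw [← Multiset.mem_toFinset, h1, Multiset.mem_toFinset]
    exact Multiset.mem_add.2 (Or.inr hA)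
  simp only [smsTM_insert]
  rw [← Set.union_assoc, Set.union_eq_left.2 this]

theorem step_sound {S : Type} (σ : ℕ → Set (Set S) × Set (Set S)) {α β : SmsDatum}
    (h : ETDCStep α β) : SmsTM σ α = SmsTM σ β := by
  rcases h with h | h | h | h
  · exact mg_sound σ h
  · exact (mg_sound σ h).symm
  · exact ir_sound σ h
  · exact (ir_sound σ h).symm

theorem ded_sound {α β : SmsDatum} (h : Relation.ReflTransGen ETDCStep α β) :
    ETEquiv α β := by
  intro S σ _
  induction h with
  | refl => rfl
  | tail _ h ih => exact ih.trans (step_sound σ h)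

theorem ded_symm {α β : SmsDatum} (h : Relation.ReflTransGen ETDCStep α β) :
    Relation.ReflTransGen ETDCStep β α := by
  have key : ∀ a b, ETDCStep a b → ETDCStep b a := by
    intro a b hab
    rcases hab with h | h | h | h
    · exact Or.inr (Or.inl h)
    · exact Or.inl h
    · exact Or.inr (Or.inr (Or.inr h))
    · exact Or.inr (Or.inr (Or.inl h))
  induction h with
  | refl => exact .refl
  | tail _ h ih => exact ih.head (key _ _ h)

def IsLit (A : Fml) : Prop := (∃ p, A = .var p) ∨ (∃ p, A = .neg (.var p))

def fsize : Fml → ℕ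
  | .var _ => 1
  | .neg A => fsize A + 1
  | .conj A B => fsize A + fsize B + 2
  | .disj A B => fsize A + fsize B + 2

def LitDatum (D : SmsDatum) : Prop := ∀ Γ ∈ D, ∀ A ∈ Γ, IsLit A

theorem reduce_comp (n : ℕ) : ∀ Γ : Multiset Fml, (Γ.map fsize).sum = n →
    ∃ D : SmsDatum, LitDatum D ∧
      ∀ ρ, Relation.ReflTransGen ETDCStep (insert Γ ρ) (D ∪ ρ) := by
  induction n using Nat.strong_induction_on with
  | _ n ih =>
  intro Γ hn
  by_cases hL : ∀ A ∈ Γ, IsLit A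
  · refine ⟨{Γ}, ?_, fun ρ => ?_⟩
    · intro Δ hΔ
      rw [Finset.mem_singleton.1 hΔ]; exact hL
    · exact Relation.ReflTransGen.refl
  · push Not at hL
    obtain ⟨A, hA, hnl⟩ := hL
    obtain ⟨Γ, rfl⟩ := Multiset.exists_cons_of_mem hA
    have one : ∀ Δ : Multiset Fml, (Δ.map fsize).sum < n →
        (∀ ρ, MGStep (insert (A ::ₘ Γ) ρ) (insert Δ ρ)) →
        ∃ D : SmsDatum, LitDatum D ∧
          ∀ ρ, Relation.ReflTransGen ETDCStep (insert (A ::ₘ Γ) ρ) (D ∪ ρ) := by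
      intro Δ hΔ hst
      obtain ⟨D, hD, hd⟩ := ih _ hΔ Δ rfl
      exact ⟨D, hD, fun ρ => Relation.ReflTransGen.head (Or.inl (hst ρ)) (hd ρ)⟩
    have two : ∀ Δ Θ : Multiset Fml, (Δ.map fsize).sum < n → (Θ.map fsize).sum < n →
        (∀ ρ, MGStep (insert (A ::ₘ Γ) ρ) (insert Δ (insert Θ ρ))) →
        ∃ D : SmsDatum, LitDatum D ∧
          ∀ ρ, Relation.ReflTransGen ETDCStep (insert (A ::ₘ Γ) ρ) (D ∪ ρ) := by
      intro Δ Θ hΔ hΘ hst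
      obtain ⟨D, hD, hd⟩ := ih _ hΔ Δ rfl
      obtain ⟨E, hE, he⟩ := ih _ hΘ Θ rfl
      refine ⟨E ∪ D, ?_, fun ρ => Relation.ReflTransGen.head (Or.inl (hst ρ)) ?_⟩
      · intro X hX
        rcases Finset.mem_union.1 hX with h | h
        · exact hE X h
        · exact hD X h
      · refine (hd _).trans ?_
        rw [Finset.union_insert, Finset.union_assoc]
        exact he _
    simp only [Multiset.map_cons, Multiset.sum_cons] at hn
    cases A with
    | var p => exact absurd (Or.inl ⟨p, rfl⟩) hnl
    | conj A B =>
      simp only [fsize] at hn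
      exact one (A ::ₘ B ::ₘ Γ) (by simp only [Multiset.map_cons, Multiset.sum_cons]; omega)
        (fun ρ => .conj Γ A B ρ)
    | disj A B =>
      simp only [fsize] at hn
      exact two (A ::ₘ Γ) (B ::ₘ Γ)
        (by simp only [Multiset.map_cons, Multiset.sum_cons]; omega)
        (by simp only [Multiset.map_cons, Multiset.sum_cons]; omega)
        (fun ρ => .disj Γ A B ρ)
    | neg C =>
      cases C with
      | var p => exact absurd (Or.inr ⟨p, rfl⟩) hnl
      | neg A =>
        simp only [fsize] at hn
        exact one (A ::ₘ Γ) (by simp only [Multiset.map_cons, Multiset.sum_cons]; omega)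
          (fun ρ => .negneg Γ A ρ)
      | conj A B =>
        simp only [fsize] at hn
        exact two (A.neg ::ₘ Γ) (B.neg ::ₘ Γ)
          (by simp only [Multiset.map_cons, Multiset.sum_cons, fsize]; omega)
          (by simp only [Multiset.map_cons, Multiset.sum_cons, fsize]; omega)
          (fun ρ => .negconj Γ A B ρ)
      | disj A B =>
        simp only [fsize] at hn
        exact one (A.neg ::ₘ B.neg ::ₘ Γ)
          (by simp only [Multiset.map_cons, Multiset.sum_cons, fsize]; omega)
          (fun ρ => .negdisj Γ A B ρ)

theorem reduce_datum (α : SmsDatum) : ∃ D : SmsDatum, LitDatum D ∧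
      ∀ ρ, Relation.ReflTransGen ETDCStep (α ∪ ρ) (D ∪ ρ) := by
  induction α using Finset.induction_on with
  | empty => exact ⟨∅, by intro X hX; simp at hX, fun ρ => .refl⟩
  | insert Γ α _ ih =>
    obtain ⟨D, hD, hd⟩ := ih
    obtain ⟨E, hE, he⟩ := reduce_comp _ Γ rfl
    refine ⟨D ∪ E, ?_, fun ρ => ?_⟩
    · intro X hX
      rcases Finset.mem_union.1 hX with h | h
      · exact hD X h
      · exact hE X h
    · rw [Finset.insert_union]
      refine (he _).trans ?_
      rw [Finset.union_left_comm, Finset.union_assoc]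
      exact hd _

def canon (p : ℕ) : Set (Set (Fml × ℕ)) × Set (Set (Fml × ℕ)) :=
  (Set.range fun i => {(Fml.var p, i)}, Set.range fun i => {(Fml.neg (Fml.var p), i)})

theorem canon_model : IsModel canon := by
  intro p h
  have : ({(Fml.var p, 0)} : Set (Fml × ℕ)) ∈ (canon p).1 := ⟨0, rfl⟩
  rw [h] at this
  obtain ⟨i, hi⟩ := this
  simp at hi

theorem canon_lit {A : Fml} (h : IsLit A) :
    (Sem canon A).1 = Set.range fun i => {(A, i)} := by
  rcases h with ⟨p, rfl⟩ | ⟨p, rfl⟩ <;> rfl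

def full (Γ : Multiset Fml) : Set (Fml × ℕ) := {x | x.2 < Γ.count x.1}

theorem full_mem (Γ : Multiset Fml) (h : ∀ A ∈ Γ, IsLit A) : full Γ ∈ MsetTM canon Γ := by
  induction Γ using Multiset.induction_on with
  | empty => rw [msetTM_zero]; ext; simp [full]
  | cons A Γ ih =>
    rw [msetTM_cons]
    refine ⟨{(A, Γ.count A)}, ?_, full Γ, ih fun B hB => h B (Multiset.mem_cons_of_mem hB), ?_⟩
    · rw [canon_lit (h A (Multiset.mem_cons_self _ _))]
      exact ⟨_, rfl⟩
    · ext ⟨B, i⟩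
      simp only [full, Set.mem_setOf_eq, Multiset.count_cons, Set.mem_union,
        Set.mem_singleton_iff, Prod.mk.injEq]
      by_cases hB : B = A
      · subst hB; simp; omega
      · simp [hB]

theorem canon_bound (Γ : Multiset Fml) (h : ∀ A ∈ Γ, IsLit A) : ∀ s ∈ MsetTM canon Γ,
    ∀ A, {i | (A, i) ∈ s}.encard ≤ Γ.count A ∧ (A ∈ Γ → ∃ i, (A, i) ∈ s) := by
  induction Γ using Multiset.induction_on with
  | empty =>
    intro s hs A
    rw [msetTM_zero] at hs
    subst hs
    simp
  | cons B Γ ih =>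
    intro s hs A
    rw [msetTM_cons, canon_lit (h B (Multiset.mem_cons_self _ _))] at hs
    obtain ⟨_, ⟨j, rfl⟩, t, ht, rfl⟩ := hs
    obtain ⟨h1, h2⟩ := ih (fun B hB => h B (Multiset.mem_cons_of_mem hB)) t ht A
    by_cases hA : A = B
    · subst hA
      refine ⟨?_, fun _ => ⟨j, Or.inl rfl⟩⟩
      have : {i | (A, i) ∈ {(A, j)} ∪ t} = insert j {i | (A, i) ∈ t} := by
        ext i; simp
      rw [this, Multiset.count_cons_self]
      refine (Set.encard_insert_le _ _).trans ?_
      push_cast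
      gcongr
    · refine ⟨?_, fun hm => ?_⟩
      · have : {i | (A, i) ∈ {(B, j)} ∪ t} = {i | (A, i) ∈ t} := by
          ext i; simp [hA]
        rw [this, Multiset.count_cons_of_ne hA]
        exact h1
      · obtain ⟨i, hi⟩ := h2 ((Multiset.mem_cons.1 hm).resolve_left hA)
        exact ⟨i, Or.inr hi⟩

theorem replica_of_full {Γ Δ : Multiset Fml} (hΔ : ∀ A ∈ Δ, IsLit A)
    (h : full Γ ∈ MsetTM canon Δ) : InferiorReplica Γ Δ := by
  have hb := canon_bound Δ hΔ _ h
  have hle : Γ ≤ Δ := by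
    rw [Multiset.le_iff_count]
    intro A
    have h1 := (hb A).1
    have : {i | (A, i) ∈ full Γ} = ((Finset.range (Γ.count A) : Finset ℕ) : Set ℕ) := by
      ext i; simp [full]
    rw [this, Set.encard_coe_eq_coe_finsetCard, Finset.card_range] at h1
    exact_mod_cast h1
  refine ⟨?_, hle⟩
  ext A
  simp only [Multiset.mem_toFinset]
  refine ⟨fun hA => Multiset.mem_of_le hle hA, fun hA => ?_⟩
  obtain ⟨i, hi⟩ := (hb A).2 hA
  have hi : i < Γ.count A := hi
  exact Multiset.count_pos.1 (by omega)

theorem add_replicas (D : SmsDatum) (E : SmsDatum)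
    (h : ∀ Γ ∈ E, ∃ Δ ∈ D, InferiorReplica Γ Δ) :
    Relation.ReflTransGen ETDCStep D (E ∪ D) := by
  induction E using Finset.induction_on with
  | empty => rw [Finset.empty_union]
  | insert Γ E _ ih =>
    refine (ih fun X hX => h X (Finset.mem_insert_of_mem hX)).tail ?_
    obtain ⟨Δ, hΔ, hr⟩ := h Γ (Finset.mem_insert_self _ _)
    refine Or.inr (Or.inr (Or.inl ⟨Δ, Γ, E ∪ D, hr, ?_, ?_⟩))
    · rw [Finset.insert_eq_of_mem (Finset.mem_union_right _ hΔ)]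
    · rw [Finset.insert_union, Finset.insert_eq_of_mem (a := Δ)]
      exact Finset.mem_insert_of_mem (Finset.mem_union_right _ hΔ)

theorem lit_replicas {D E : SmsDatum} (hD : LitDatum D) (hE : LitDatum E)
    (h : SmsTM canon E ⊆ SmsTM canon D) : ∀ Γ ∈ E, ∃ Δ ∈ D, InferiorReplica Γ Δ := by
  intro Γ hΓ
  have h1 : full Γ ∈ SmsTM canon E := by
    simp only [SmsTM, Set.mem_iUnion]
    exact ⟨Γ, hΓ, full_mem Γ (hE Γ hΓ)⟩
  have h2 := h h1
  simp only [SmsTM, Set.mem_iUnion] at h2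
  obtain ⟨Δ, hΔ, hm⟩ := h2
  exact ⟨Δ, hΔ, replica_of_full (hD Δ hΔ) hm⟩

/-- Soundness and completeness of ETDC: β is ETDC-deducible from α iff
α ≃_ET β. -/
theorem etdc_soundness_completeness (α β : SmsDatum) :
    Relation.ReflTransGen ETDCStep α β ↔ ETEquiv α β := by
  refine ⟨ded_sound, fun h => ?_⟩
  obtain ⟨D, hD, hd⟩ := reduce_datum α
  obtain ⟨E, hE, he⟩ := reduce_datum β
  have hd := hd ∅
  have he := he ∅
  simp only [Finset.union_empty] at hd he
  have heq : SmsTM canon D = SmsTM canon E := by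
    rw [← ded_sound hd _ canon canon_model, ← ded_sound he _ canon canon_model]
    exact h _ canon canon_model
  have h1 := add_replicas D E (lit_replicas hD hE heq.ge)
  have h2 := add_replicas E D (lit_replicas hE hD heq.le)
  rw [Finset.union_comm] at h2
  exact hd.trans (h1.trans ((ded_symm h2).trans (ded_symm he)))
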